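/- For every x > 0, the function y ↦ (y²/sinh y)·( (x−y)²/sinh|x−y| + (x+y)²/sinh(x+y) ) is integrable on (0,∞) (the point y = x being negligible), and the collision frequency Γ(x) = sinh(x) ∫₀^∞ (y²/sinh y)·( (x−y)²/sinh|x−y| + (x+y)²/sinh(x+y) ) dy is finite and strictly positive. -/

import Mathlib

open MeasureTheory Real Set

lemma aux_bound (t : ℝ) (ht : 0 ≤ t) : t ^ 2 / Real.sinh t ≤ 8 * Real.exp (-(1/4) * t) := by
  rcases ht.eq_or_lt with rfl | ht
  · simp
  have hs : 0 < Real.sinh t := Real.sinh_pos_iff.2 ht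
  rw [div_le_iff₀ hs]
  have h1 : Real.sinh t = 2 * Real.sinh (t/2) * Real.cosh (t/2) := by
    rw [← Real.sinh_two_mul]; congr 1; ring
  have h2 : t / 2 ≤ Real.sinh (t/2) := Real.self_le_sinh_iff.2 (by positivity)
  have h3 : Real.exp (t/2) / 2 ≤ Real.cosh (t/2) := by
    rw [Real.cosh_eq]; have := Real.exp_pos (-(t/2)); linarith
  have h4 : Real.exp (t/2) = Real.exp (t/4) * Real.exp (t/4) := by
    rw [← Real.exp_add]; congr 1; ring
  have h5 : Real.exp (-(1/4) * t) * Real.exp (t/4) = 1 := by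
    rw [← Real.exp_add, Real.exp_eq_one_iff]; ring
  have h6 : t/4 ≤ Real.exp (t/4) := by have := Real.add_one_le_exp (t/4); linarith
  have h7 : t / 2 * (Real.exp (t/2) / 2) ≤ Real.sinh (t/2) * Real.cosh (t/2) := by gcongr
  have e0 := Real.exp_pos (-(1/4) * t)
  calc t ^ 2 ≤ 4 * t * Real.exp (t/4) := by nlinarith
    _ = 4 * t * Real.exp (t/4) * (Real.exp (-(1/4) * t) * Real.exp (t/4)) := by rw [h5, mul_one]
    _ = 8 * Real.exp (-(1/4) * t) * (2 * (t / 2 * (Real.exp (t/2) / 2))) := by rw [h4]; ring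
    _ ≤ 8 * Real.exp (-(1/4) * t) * Real.sinh t := by
      rw [h1]
      exact mul_le_mul_of_nonneg_left (by linarith) (by positivity)

lemma aux_bound' (t : ℝ) (ht : 0 ≤ t) : t ^ 2 / Real.sinh t ≤ 8 := by
  have h := aux_bound t ht
  have : Real.exp (-(1/4) * t) ≤ 1 := Real.exp_le_one_iff.2 (by linarith)
  linarith

lemma aux_nonneg (t : ℝ) (ht : 0 ≤ t) : 0 ≤ t ^ 2 / Real.sinh t :=
  div_nonneg (sq_nonneg _) (Real.sinh_nonneg_iff.2 ht)

/-- For every `x > 0` the integrand defining the collision frequency `Γ(x)` is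
integrable on `(0,∞)`, and
`Γ(x) = sinh x ∫₀^∞ (y²/sinh y)((x−y)²/sinh|x−y| + (x+y)²/sinh(x+y)) dy`
is finite and strictly positive. -/
theorem collisionFrequency_integrable_pos (x : ℝ) (hx : 0 < x) :
    IntegrableOn
      (fun y : ℝ => y ^ 2 / Real.sinh y *
        ((x - y) ^ 2 / Real.sinh |x - y| + (x + y) ^ 2 / Real.sinh (x + y)))
      (Ioi 0) ∧
    0 < Real.sinh x * ∫ y in Ioi (0 : ℝ),
        y ^ 2 / Real.sinh y *
          ((x - y) ^ 2 / Real.sinh |x - y| + (x + y) ^ 2 / Real.sinh (x + y)) := by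
  have hA : ∀ y : ℝ, 0 ≤ (x - y) ^ 2 / Real.sinh |x - y| ∧
      (x - y) ^ 2 / Real.sinh |x - y| ≤ 8 := fun y => by
    rw [← sq_abs (x - y)]
    exact ⟨aux_nonneg _ (abs_nonneg _), aux_bound' _ (abs_nonneg _)⟩
  have hpos : ∀ y ∈ Ioi (0 : ℝ), 0 < y ^ 2 / Real.sinh y *
        ((x - y) ^ 2 / Real.sinh |x - y| + (x + y) ^ 2 / Real.sinh (x + y)) := by
    intro y hy
    have hy : 0 < y := hy
    have h1 : 0 < Real.sinh y := Real.sinh_pos_iff.2 hy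
    have h2 : 0 < Real.sinh (x + y) := Real.sinh_pos_iff.2 (by positivity)
    have h3 := (hA y).1
    positivity
  have hint : IntegrableOn
      (fun y : ℝ => y ^ 2 / Real.sinh y *
        ((x - y) ^ 2 / Real.sinh |x - y| + (x + y) ^ 2 / Real.sinh (x + y)))
      (Ioi 0) := by
    have hd : IntegrableOn (fun y : ℝ => 8 * Real.exp (-(1/4) * y) * 16) (Ioi 0) :=
      ((integrableOn_exp_mul_Ioi (a := -(1/4)) (by norm_num) 0).const_mul 8).mul_const 16
    refine Integrable.mono' hd ?_ ?_
    · have hm : Measurable Real.sinh := Real.measurable_sinh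
      have : Measurable (fun y : ℝ => |x - y|) := (continuous_const.sub continuous_id).abs.measurable
      exact Measurable.aestronglyMeasurable (by fun_prop)
    · filter_upwards [ae_restrict_mem measurableSet_Ioi] with y hy
      rw [Real.norm_of_nonneg (hpos y hy).le]
      have hy : 0 < y := hy
      have h1 := aux_bound y hy.le
      have h2 := aux_bound' (x + y) (by positivity)
      have h3 := aux_nonneg (x + y) (by positivity)
      have h4 := hA y
      exact mul_le_mul h1 (by linarith) (by linarith) (by positivity)
  refine ⟨hint, mul_pos (Real.sinh_pos_iff.2 hx) ?_⟩
  rw [setIntegral_pos_iff_support_of_nonneg_ae _ hint]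
  · rw [inter_eq_self_of_subset_right]
    · simp
    · exact fun y hy => (hpos y hy).ne'
  · filter_upwards [ae_restrict_mem measurableSet_Ioi] with y hy using (hpos y hy).le
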